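/- Let M be a stable d×d matrix and set Λ = M + I. Suppose the spectral radius of Λ is strictly less than 1. Then the solution Σ of the Lyapunov equation MΣ + ΣMᵀ + C = 0 (for C positive semidefinite) is given by the absolutely convergent series Σ = ∑_{n≥0} ∑_{m≥0} 2^{-n-m-1} · binom(n+m, n) · Λⁿ C (Λᵐ)ᵀ. -/

import Mathlib

open Matrix

attribute [local instance] Matrix.linftyOpNormedAddCommGroup

open Filter Topology in
/-- In a complex Banach algebra, the powers of an element of spectral radius `< 1` are summable. -/
theorem lyap_summable_pow {A : Type*} [NormedRing A] [NormedAlgebra ℂ A] [CompleteSpace A]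
    (a : A) (h : ∀ μ ∈ spectrum ℂ a, ‖μ‖ < 1) : Summable (fun n : ℕ => ‖a ^ n‖) := by
  rcases subsingleton_or_nontrivial A with hA | hA
  · have : (fun n : ℕ => ‖a ^ n‖) = fun _ => 0 := by
      funext n
      rw [Subsingleton.elim (a ^ n) 0, norm_zero]
    rw [this]
    exact summable_zero
  have h1 : spectralRadius ℂ a < ((1 : NNReal) : ENNReal) :=
    spectrum.spectralRadius_lt_of_forall_lt_of_nonempty (spectrum.nonempty a)
      (fun k hk => by exact_mod_cast h k hk)
  obtain ⟨r, hr, hr1⟩ := ENNReal.lt_iff_exists_nnreal_btwn.1 h1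
  have hr1' : (r : ℝ) < 1 := by exact_mod_cast hr1
  have h2 := (spectrum.pow_nnnorm_pow_one_div_tendsto_nhds_spectralRadius a).eventually_lt_const hr
  refine Summable.of_norm_bounded_eventually_nat
    (summable_geometric_of_lt_one r.coe_nonneg hr1') ?_
  filter_upwards [h2, eventually_gt_atTop 0] with n hn hn0
  have hn0' : (0 : ℝ) < n := by exact_mod_cast hn0
  rw [one_div, ENNReal.rpow_inv_lt_iff hn0', ENNReal.rpow_natCast] at hn
  rw [norm_norm]
  exact_mod_cast hn.le

section

attribute [local instance] Matrix.linftyOpNormedRing Matrix.linftyOpNormedAlgebra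

theorem lyap_summable_pow_complex {d : ℕ} (L : Matrix (Fin d) (Fin d) ℂ)
    (h : ∀ μ ∈ spectrum ℂ L, ‖μ‖ < 1) : Summable (fun n : ℕ => ‖L ^ n‖) :=
  lyap_summable_pow L h

end

theorem lyap_summable_pow_real {d : ℕ} (L : Matrix (Fin d) (Fin d) ℝ)
    (h : ∀ μ ∈ spectrum ℂ (L.map Complex.ofReal), ‖μ‖ < 1) :
    Summable (fun n : ℕ => ‖L ^ n‖) := by
  refine (lyap_summable_pow_complex _ h).congr fun n => ?_
  have : (L.map Complex.ofReal) ^ n = (L ^ n).map Complex.ofReal :=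
    (map_pow (Complex.ofRealHom.mapMatrix) L n).symm
  rw [this, Matrix.linfty_opNorm_def, Matrix.linfty_opNorm_def]
  simp

section

attribute [local instance] Matrix.linftyOpNormedSpace

theorem lyap_transpose_bound (d : ℕ) :
    ∃ K : ℝ, ∀ A : Matrix (Fin d) (Fin d) ℝ, ‖Aᵀ‖ ≤ K * ‖A‖ := by
  refine ⟨d, fun A => ?_⟩
  have hrow : ∀ i j, ‖A i j‖₊ ≤ ‖A‖₊ := by
    intro i j
    rw [Matrix.linfty_opNNNorm_def]
    exact (Finset.single_le_sum (f := fun j => ‖A i j‖₊) (fun _ _ => zero_le) (Finset.mem_univ j)).trans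
      (Finset.le_sup (f := fun i => ∑ j, ‖A i j‖₊) (Finset.mem_univ i))
  have : ‖Aᵀ‖₊ ≤ d * ‖A‖₊ := by
    rw [Matrix.linfty_opNNNorm_def Aᵀ]
    refine Finset.sup_le fun i _ => ?_
    refine (Finset.sum_le_card_nsmul _ _ ‖A‖₊ fun j _ => hrow j i).trans ?_
    simp
  exact_mod_cast this

theorem lyap_complete (d : ℕ) : CompleteSpace (Matrix (Fin d) (Fin d) ℝ) :=
  FiniteDimensional.complete ℝ _

theorem lyap_complete' (d : ℕ) :
    @CompleteSpace (Matrix (Fin d) (Fin d) ℝ)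
      (Matrix.linftyOpNormedAddCommGroup : NormedAddCommGroup (Matrix (Fin d) (Fin d) ℝ)).toMetricSpace.toPseudoMetricSpace.toUniformSpace :=
  inferInstanceAs (CompleteSpace (Fin d → Fin d → ℝ))

theorem lyap_summable {d : ℕ} (L X : Matrix (Fin d) (Fin d) ℝ)
    (h : ∀ μ ∈ spectrum ℂ (L.map Complex.ofReal), ‖μ‖ < 1) :
    Summable (fun p : ℕ × ℕ =>
        ‖(((1 : ℝ) / 2) ^ (p.1 + p.2 + 1) * ((p.1 + p.2).choose p.1 : ℝ)) •
          (L ^ p.1 * X * (L ^ p.2)ᵀ)‖) := by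
  obtain ⟨K, hK⟩ := lyap_transpose_bound d
  have hs := lyap_summable_pow_real L h
  have hp : Summable (fun p : ℕ × ℕ => (‖X‖ * K) * (‖L ^ p.1‖ * ‖L ^ p.2‖)) :=
    (hs.mul_of_nonneg hs (fun _ => norm_nonneg _) (fun _ => norm_nonneg _)).mul_left _
  refine Summable.of_nonneg_of_le (fun _ => norm_nonneg _) (fun p => ?_) hp
  have hc0 : (0 : ℝ) ≤ ((1 : ℝ) / 2) ^ (p.1 + p.2 + 1) * ((p.1 + p.2).choose p.1 : ℝ) := by
    positivity
  have hc1 : ((1 : ℝ) / 2) ^ (p.1 + p.2 + 1) * ((p.1 + p.2).choose p.1 : ℝ) ≤ 1 := by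
    have h1 : ((p.1 + p.2).choose p.1 : ℝ) ≤ 2 ^ (p.1 + p.2) := by
      exact_mod_cast Nat.choose_le_two_pow (p.1 + p.2) p.1
    calc ((1 : ℝ) / 2) ^ (p.1 + p.2 + 1) * ((p.1 + p.2).choose p.1 : ℝ)
        ≤ ((1 : ℝ) / 2) ^ (p.1 + p.2 + 1) * 2 ^ (p.1 + p.2) := by gcongr
      _ = 1 / 2 := by
        rw [pow_succ, mul_right_comm, ← mul_pow]
        norm_num
      _ ≤ 1 := by norm_num
  rw [norm_smul, Real.norm_of_nonneg hc0]
  calc _ ≤ 1 * ‖L ^ p.1 * X * (L ^ p.2)ᵀ‖ := by gcongr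
    _ ≤ ‖L ^ p.1‖ * ‖X‖ * (K * ‖L ^ p.2‖) := by
      rw [one_mul]
      refine (Matrix.linfty_opNorm_mul _ _).trans ?_
      gcongr
      · exact Matrix.linfty_opNorm_mul _ _
      · exact hK _
    _ = _ := by ring

end

/-- The operator `X ↦ (L X + X Lᵀ) / 2`. -/
noncomputable def lyapT {d : ℕ} (L : Matrix (Fin d) (Fin d) ℝ) :
    Module.End ℝ (Matrix (Fin d) (Fin d) ℝ) :=
  ((1 : ℝ) / 2) • (LinearMap.mulLeft ℝ L + LinearMap.mulRight ℝ Lᵀ)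

theorem lyapT_pow {d : ℕ} (L X : Matrix (Fin d) (Fin d) ℝ) (k : ℕ) :
    ∑ p ∈ Finset.HasAntidiagonal.antidiagonal k,
      (((1 : ℝ) / 2) ^ (p.1 + p.2 + 1) * ((p.1 + p.2).choose p.1 : ℝ)) •
          (L ^ p.1 * X * (L ^ p.2)ᵀ) = ((1 : ℝ) / 2) • (lyapT L ^ k) X := by
  have hcomm : Commute (LinearMap.mulLeft ℝ L) (LinearMap.mulRight ℝ Lᵀ) :=
    LinearMap.commute_mulLeft_right L Lᵀ
  rw [lyapT, smul_pow, hcomm.add_pow']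
  rw [LinearMap.smul_apply, LinearMap.sum_apply, smul_smul, Finset.smul_sum]
  refine Finset.sum_congr rfl fun p hp => ?_
  rw [Finset.HasAntidiagonal.mem_antidiagonal] at hp
  rw [hp, LinearMap.pow_mulLeft, LinearMap.pow_mulRight, LinearMap.smul_apply,
    Module.End.mul_apply, LinearMap.mulLeft_apply, LinearMap.mulRight_apply,
    ← Nat.cast_smul_eq_nsmul ℝ, smul_smul, Matrix.transpose_pow, mul_assoc, pow_succ']

/-- Trek-rule series for the Lyapunov solution: if `M` is stable, `C` PSD, and
`Λ = M + I` has spectral radius `< 1`, then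
`Σ = ∑_{n,m} 2^{-n-m-1} binom(n+m,n) Λⁿ C (Λᵐ)ᵀ`, converging absolutely. -/
theorem lyapunov_series_representation {d : ℕ} (M C S : Matrix (Fin d) (Fin d) ℝ)
    (hM : ∀ μ ∈ spectrum ℂ (M.map Complex.ofReal), μ.re < 0)
    (hC : C.PosSemidef)
    (hΛ : ∀ μ ∈ spectrum ℂ ((M + 1).map Complex.ofReal), ‖μ‖ < 1)
    (hS : M * S + S * Mᵀ + C = 0) :
    Summable (fun p : ℕ × ℕ =>
        ‖(((1 : ℝ) / 2) ^ (p.1 + p.2 + 1) * ((p.1 + p.2).choose p.1 : ℝ)) •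
          ((M + 1) ^ p.1 * C * ((M + 1) ^ p.2)ᵀ)‖) ∧
      S = ∑' p : ℕ × ℕ,
        (((1 : ℝ) / 2) ^ (p.1 + p.2 + 1) * ((p.1 + p.2).choose p.1 : ℝ)) •
          ((M + 1) ^ p.1 * C * ((M + 1) ^ p.2)ᵀ) := by
  have := lyap_complete' d
  have hsum := fun X => lyap_summable (M + 1) X hΛ
  refine ⟨hsum C, ?_⟩
  have hanti : ∀ X, HasSum (fun k : ℕ => ((1 : ℝ) / 2) • (lyapT (M + 1) ^ k) X)
      (∑' p : ℕ × ℕ, (((1 : ℝ) / 2) ^ (p.1 + p.2 + 1) * ((p.1 + p.2).choose p.1 : ℝ)) •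
          ((M + 1) ^ p.1 * X * ((M + 1) ^ p.2)ᵀ)) := by
    intro X
    have h0 : Summable (fun p : ℕ × ℕ =>
        (((1 : ℝ) / 2) ^ (p.1 + p.2 + 1) * ((p.1 + p.2).choose p.1 : ℝ)) •
          ((M + 1) ^ p.1 * X * ((M + 1) ^ p.2)ᵀ)) := (hsum X).of_norm
    have h1 := (Finset.HasAntidiagonal.sigmaAntidiagonalEquivProd (A := ℕ)).hasSum_iff.2
      h0.hasSum
    have h2 := h1.sigma (fun k => hasSum_fintype _)
    convert h2 using 1
    funext k
    rw [← lyapT_pow, ← Finset.sum_coe_sort]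
    rfl
  have hC' : C = (2 : ℝ) • (S - lyapT (M + 1) S) := by
    have : C = -(M * S + S * Mᵀ) := by rw [eq_neg_iff_add_eq_zero, add_comm]; exact hS
    simp only [lyapT, LinearMap.smul_apply, LinearMap.add_apply, LinearMap.mulLeft_apply,
      LinearMap.mulRight_apply, Matrix.transpose_add, Matrix.transpose_one, add_mul, mul_add,
      one_mul, mul_one]
    rw [this]
    module
  have hlim : Filter.Tendsto (fun k : ℕ => (lyapT (M + 1) ^ k) S) Filter.atTop (nhds 0) := by
    have := (hanti S).summable.tendsto_atTop_zero.const_smul (2 : ℝ)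
    simpa [smul_smul] using this
  have hpart : ∀ N : ℕ, ∑ k ∈ Finset.range N, ((1 : ℝ) / 2) • (lyapT (M + 1) ^ k) C
      = S - (lyapT (M + 1) ^ N) S := by
    intro N
    induction N with
    | zero => simp
    | succ N ih =>
      rw [Finset.sum_range_succ, ih, hC', map_smul, map_sub, ← Module.End.mul_apply, ← pow_succ]
      module
  have h3 := (hanti C).tendsto_sum_nat
  simp only [hpart] at h3
  refine tendsto_nhds_unique ?_ h3
  simpa using hlim.const_sub S
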